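/- Let K be a commutative ring and let T be a K-linear additive category in which idempotents split and such that the endomorphism ring of every object is left and right artinian. Then every endomorphism ν : Z → Z of an object Z of T admits a Fitting decomposition: there exist objects Z′ and Z″ and an isomorphism φ : Z ≅ Z′ ⊕ Z″ such that φ ∘ ν ∘ φ⁻¹ is the biproduct morphism ν′ ⊕ ν″ for some automorphism ν′ of Z′ and some nilpotent endomorphism ν″ of Z″. -/

import Mathlib

open CategoryTheory CategoryTheory.Limits

attribute [local instance] CategoryTheory.Limits.hasBinaryBiproducts_of_finite_biproducts

/-- In an artinian ring, every sufficiently high power `a ^ m` is a left multiple of its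
square. -/
theorem IsArtinianRing.exists_forall_ge_mul_pow_mul_pow_eq {R : Type*} [Ring R]
    [IsArtinianRing R] (a : R) : ∃ n, ∀ m ≥ n, ∃ x, x * (a ^ m * a ^ m) = a ^ m := by
  let f : ℕ →o (Submodule R R)ᵒᵈ :=
    ⟨fun k => OrderDual.toDual (Ideal.span {a ^ k}), fun k l hkl => by
      change Ideal.span {a ^ l} ≤ Ideal.span {a ^ k}
      rw [Ideal.span_singleton_le_iff_mem, Ideal.mem_span_singleton']
      exact ⟨a ^ (l - k), by rw [← pow_add, Nat.sub_add_cancel hkl]⟩⟩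
  obtain ⟨n, hn⟩ := IsArtinian.monotone_stabilizes f
  refine ⟨n, fun m hm => ?_⟩
  have h : Ideal.span {a ^ m} = Ideal.span {a ^ (m + m)} :=
    (hn m hm).symm.trans (hn (m + m) (by omega))
  have hmem : a ^ m ∈ Ideal.span {a ^ (m + m)} := h ▸ Ideal.mem_span_singleton_self _
  simpa [Ideal.mem_span_singleton', pow_add] using hmem

/-- If `b` is both a left and a right multiple of its square, then `b` is invertible in the
corner ring of some idempotent `e`, and `e` commutes with everything that commutes with `b`. -/
theorem exists_idempotent_of_mul_mul_self_eq {R : Type*} [Ring R] {b x y : R}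
    (hx : x * (b * b) = b) (hy : (b * b) * y = b) :
    ∃ e c : R, e * e = e ∧ b * e = b ∧ b * c = e ∧ c * b = e ∧
      ∀ a, Commute a b → a * e = e * a := by
  have hxy : x * b = b * y := by
    calc x * b = x * (b * b * y) := by rw [hy]
      _ = x * (b * b) * y := by noncomm_ring
      _ = b * y := by rw [hx]
  have hbe : b * (b * y) = b := by rw [← mul_assoc, hy]
  have heb : b * y * b = b := by rw [← hxy, mul_assoc, hx]
  have hbc : b * (x * b * y) = b * y := by
    rw [hxy, ← mul_assoc, hbe]
  have hcb : x * b * y * b = b * y := by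
    rw [mul_assoc x b y, mul_assoc x, heb, hxy]
  refine ⟨b * y, x * b * y, ?_, hbe, hbc, hcb, fun a ha => ?_⟩
  · rw [← mul_assoc, heb]
  · have h₁ : a * (b * y) = b * y * a * (b * y) := by
      calc a * (b * y) = a * (b * (x * b * y)) := by rw [hbc]
        _ = b * a * (x * b * y) := by rw [← mul_assoc, ha.eq]
        _ = b * y * b * a * (x * b * y) := by rw [heb]
        _ = b * y * (b * a) * (x * b * y) := by noncomm_ring
        _ = b * y * (a * b) * (x * b * y) := by rw [ha.eq]
        _ = b * y * a * (b * (x * b * y)) := by noncomm_ring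
        _ = b * y * a * (b * y) := by rw [hbc]
    have h₂ : b * y * a = b * y * a * (b * y) := by
      calc b * y * a = x * b * y * b * a := by rw [hcb]
        _ = x * b * y * (b * a) := by rw [mul_assoc]
        _ = x * b * y * (a * b) := by rw [ha.eq]
        _ = x * b * y * (a * (b * (b * y))) := by rw [hbe]
        _ = x * b * y * (a * b) * (b * y) := by noncomm_ring
        _ = x * b * y * (b * a) * (b * y) := by rw [ha.eq]
        _ = x * b * y * b * a * (b * y) := by noncomm_ring
        _ = b * y * a * (b * y) := by rw [hcb]
    rw [h₁, ← h₂]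

/-- The **Fitting idempotent** of an element `a` of a left and right artinian ring: `a` is
invertible in the corner ring of `e` and nilpotent in that of `1 - e`. -/
theorem exists_fitting_idempotent {R : Type*} [Ring R] [IsArtinianRing R]
    [IsArtinianRing Rᵐᵒᵖ] (a : R) :
    ∃ e u v : R, e * e = e ∧ a * e = e * a ∧ a * u = e ∧ v * a = e ∧
      IsNilpotent (a * (1 - e)) := by
  obtain ⟨n₁, h₁⟩ := IsArtinianRing.exists_forall_ge_mul_pow_mul_pow_eq a
  obtain ⟨n₂, h₂⟩ := IsArtinianRing.exists_forall_ge_mul_pow_mul_pow_eq (MulOpposite.op a)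
  obtain ⟨x, hx⟩ := h₁ (n₁ + n₂ + 1) (by omega)
  obtain ⟨y, hy⟩ := h₂ (n₁ + n₂ + 1) (by omega)
  have hy' : a ^ (n₁ + n₂ + 1) * a ^ (n₁ + n₂ + 1) * y.unop = a ^ (n₁ + n₂ + 1) := by
    simpa only [MulOpposite.unop_mul, MulOpposite.unop_pow, MulOpposite.unop_op] using
      congrArg MulOpposite.unop hy
  obtain ⟨e, c, hee, hbe, hbc, hcb, hcomm⟩ := exists_idempotent_of_mul_mul_self_eq hx hy'
  have hae : Commute a e := hcomm a (Commute.self_pow a _)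
  refine ⟨e, a ^ (n₁ + n₂) * c, c * a ^ (n₁ + n₂), hee, hae, ?_, ?_, n₁ + n₂ + 1, ?_⟩
  · rw [← mul_assoc, ← pow_succ', hbc]
  · rw [mul_assoc, ← pow_succ, hcb]
  · have hidem : IsIdempotentElem (1 - e) := IsIdempotentElem.one_sub hee
    rw [((Commute.one_right a).sub_right hae).mul_pow, hidem.pow_succ_eq, mul_sub, mul_one, hbe,
      sub_self]

/-- **Fitting decomposition.** In a `K`-linear additive category with split idempotents in
which every endomorphism ring is left and right artinian, every endomorphism `ν` of an object
`Z` decomposes, via an isomorphism `φ : Z ≅ Z′ ⊞ Z″`, as the biproduct of an automorphism of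
`Z′` and a nilpotent endomorphism of `Z″`. -/
theorem fitting_decomposition
    (K : Type*) [CommRing K]
    (T : Type*) [Category T] [Preadditive T] [Linear K T] [HasFiniteBiproducts T]
    [IsIdempotentComplete T]
    (hart : ∀ X : T, IsArtinianRing (End X) ∧ IsArtinianRing (End X)ᵐᵒᵖ)
    (Z : T) (ν : Z ⟶ Z) :
    ∃ (Z' Z'' : T) (φ : Z ≅ Z' ⊞ Z'') (ν' : Z' ⟶ Z') (ν'' : End Z''),
      IsIso ν' ∧ IsNilpotent ν'' ∧
      φ.inv ≫ ν ≫ φ.hom = biprod.map ν' (ν'' : Z'' ⟶ Z'') := by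
  obtain ⟨_, _⟩ := hart Z
  obtain ⟨e, u, v, w, hee, hcomm, hu, hv, hw, m, hm⟩ : ∃ (e u v : Z ⟶ Z) (w : End Z),
      e ≫ e = e ∧ e ≫ ν = ν ≫ e ∧ u ≫ ν = e ∧ ν ≫ v = e ∧
        w = (𝟙 Z - e) ≫ ν ∧ IsNilpotent w := by
    obtain ⟨e, u, v, hee, hcomm, hu, hv, hnil⟩ := exists_fitting_idempotent (R := End Z) ν
    exact ⟨e, u, v, _, hee, hcomm, hu, hv, rfl, hnil⟩
  obtain ⟨Z', i, p, hip, hpi⟩ := IsIdempotentComplete.idempotents_split Z e hee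
  obtain ⟨Z'', j, q, hjq, hqj⟩ := IsIdempotentComplete.idempotents_split Z (𝟙 Z - e)
    (by simp [hee])
  have hie : i ≫ e = i := by rw [← hpi, reassoc_of% hip]
  have hep : e ≫ p = p := by rw [← hpi, Category.assoc, hip, Category.comp_id]
  have hje : j ≫ e = 0 := by
    have : j ≫ (𝟙 Z - e) = j := by rw [← hqj, reassoc_of% hjq]
    simpa using this
  have heq : e ≫ q = 0 := by
    have : (𝟙 Z - e) ≫ q = q := by rw [← hqj, Category.assoc, hjq, Category.comp_id]
    simpa using this
  have hiq : i ≫ q = 0 := by rw [← hie, Category.assoc, heq, comp_zero]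
  have hjp : j ≫ p = 0 := by rw [← hep, reassoc_of% hje, zero_comp]
  have hiνq : i ≫ ν ≫ q = 0 := by
    rw [← hie, Category.assoc, reassoc_of% hcomm, heq, comp_zero, comp_zero]
  have hjνp : j ≫ ν ≫ p = 0 := by
    rw [← hep, ← reassoc_of% hcomm, reassoc_of% hje, zero_comp]
  let φ : Z ≅ Z' ⊞ Z'' :=
    { hom := biprod.lift p q
      inv := biprod.desc i j
      hom_inv_id := by rw [biprod.lift_desc, hpi, hqj, add_sub_cancel]
      inv_hom_id := by
        ext <;> simp [hip, hjq, hiq, hjp] }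
  have hright : (i ≫ ν ≫ p) ≫ i ≫ v ≫ p = 𝟙 Z' := by
    simp only [Category.assoc]
    rw [reassoc_of% hpi, ← reassoc_of% hcomm, reassoc_of% hv, hep, hep, hip]
  have hleft : (i ≫ u ≫ p) ≫ i ≫ ν ≫ p = 𝟙 Z' := by
    simp only [Category.assoc]
    rw [reassoc_of% hpi, reassoc_of% hcomm, reassoc_of% hu, hep, hep, hip]
  have : IsSplitMono (i ≫ ν ≫ p) := .mk' ⟨_, hright⟩
  have : IsSplitEpi (i ≫ ν ≫ p) := .mk' ⟨_, hleft⟩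
  have hpow (k : ℕ) : (End.of (j ≫ ν ≫ q)) ^ k = End.of (j ≫ End.asHom (w ^ k) ≫ q) := by
    induction k with
    | zero => exact ((congrArg (j ≫ ·) (Category.id_comp q)).trans hjq).symm
    | succ k ih =>
      have hjνe : j ≫ ν ≫ e = 0 := by rw [← hcomm, reassoc_of% hje, zero_comp]
      rw [pow_succ, pow_succ, ih, hw]
      change (j ≫ ν ≫ q) ≫ j ≫ End.asHom _ ≫ q = j ≫ (((𝟙 Z - e) ≫ ν) ≫ End.asHom _) ≫ q
      simp [reassoc_of% hqj, reassoc_of% hje, reassoc_of% hjνe]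
  refine ⟨Z', Z'', φ, i ≫ ν ≫ p, End.of (j ≫ ν ≫ q), isIso_of_epi_of_isSplitMono _, ⟨m, ?_⟩, ?_⟩
  · rw [hpow, hm]
    exact (congrArg (j ≫ ·) zero_comp).trans comp_zero
  · ext <;> simp [φ, End.of, hiνq, hjνp]
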